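/- arXiv:2004.07059 — 3 statements merged into one kernel-verified Lean document; each statement's English description precedes it below -/
import Mathlib

section
/- Let a₁, a₂, a₃, a₄, a₅ be nonnegative integers with a₃ ≥ 1. Then the code C(a₁, a₂, a₃, a₄, a₅) is equivalent to the code C(a₁, a₃ − 1, a₂ + 1, a₅, a₄). -/
open Finset

/-- The finite field with four elements. -/
abbrev F4 : Type := GaloisField 2 2

noncomputable instance : Fintype F4 := Fintype.ofFinite F4

lemma F4.card_eq : Fintype.card F4 = 4 := by
  simpa using GaloisField.card 2 2 (by norm_num)

lemma F4.exists_omega : ∃ x : F4, x ^ 2 + x + 1 = 0 := by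
  classical
  obtain ⟨x, hx0, hx1⟩ : ∃ x : F4, x ≠ 0 ∧ x ≠ 1 := by
    by_contra h
    push_neg at h
    have hsub : (Finset.univ : Finset F4) ⊆ {0, 1} := by
      intro x _
      rcases eq_or_ne x 0 with h0 | h0
      · simp [h0]
      · simp [h x h0]
    have h1 := Finset.card_le_card hsub
    have h2 : ({0, 1} : Finset F4).card ≤ 2 := (Finset.card_insert_le _ _).trans (by simp)
    have h3 : (Finset.univ : Finset F4).card = 4 := F4.card_eq
    omega
  refine ⟨x, ?_⟩
  have hx : x ^ Fintype.card F4 = x := FiniteField.pow_card x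
  rw [F4.card_eq] at hx
  have hmul : x * (x - 1) * (x ^ 2 + x + 1) = 0 := by
    have : x * (x - 1) * (x ^ 2 + x + 1) = x ^ 4 - x := by ring
    rw [this, hx, sub_self]
  rcases mul_eq_zero.mp hmul with h | h
  · rcases mul_eq_zero.mp h with h | h
    · exact absurd h hx0
    · exact absurd (sub_eq_zero.mp h) hx1
  · exact h

/-- A fixed root of `X² + X + 1` in `F₄`. -/
noncomputable def ω4 : F4 := Classical.choose F4.exists_omega

lemma ω4_spec : ω4 ^ 2 + ω4 + 1 = 0 := Classical.choose_spec F4.exists_omega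

open scoped Classical in
/-- Hamming weight of a vector. -/
noncomputable def wt {n : ℕ} (x : Fin n → F4) : ℕ :=
  (Finset.univ.filter fun i => x i ≠ 0).card

/-- `C` is a code with minimum (nonzero) weight `d`. -/
noncomputable def hasMinWeight {n : ℕ} (C : Submodule F4 (Fin n → F4)) (d : ℕ) : Prop :=
  (∀ x ∈ C, x ≠ 0 → d ≤ wt x) ∧ ∃ x ∈ C, x ≠ 0 ∧ wt x = d

/-- The Hermitian inner product on `F₄ⁿ`; the conjugate of `x` is `x²`. -/
noncomputable def hermInner {n : ℕ} (u v : Fin n → F4) : F4 := ∑ i, u i * (v i) ^ 2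

/-- The Hermitian dual code. -/
noncomputable def hermDual {n : ℕ} (C : Submodule F4 (Fin n → F4)) : Submodule F4 (Fin n → F4) where
  carrier := {x | ∀ y ∈ C, hermInner x y = 0}
  zero_mem' := by intro y hy; simp [hermInner]
  add_mem' := by
    intro a b ha hb y hy
    have := ha y hy
    have := hb y hy
    simp only [hermInner, Pi.add_apply, add_mul, Finset.sum_add_distrib] at *
    simp [*]
  smul_mem' := by
    intro c a ha y hy
    have h := ha y hy
    simp only [hermInner, Pi.smul_apply, smul_eq_mul, mul_assoc, ← Finset.mul_sum] at *
    simp [h]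

/-- `C` is a Hermitian linear complementary dual code. -/
noncomputable def IsHermLCD {n : ℕ} (C : Submodule F4 (Fin n → F4)) : Prop :=
  C ⊓ hermDual C = ⊥

/-- The monomial linear map given by a permutation of coordinates followed by a
multiplication of each coordinate by a scalar. -/
noncomputable def monoMap {n : ℕ} (σ : Equiv.Perm (Fin n)) (s : Fin n → F4) :
    (Fin n → F4) →ₗ[F4] (Fin n → F4) where
  toFun x := fun i => s i * x (σ i)
  map_add' a b := by funext i; simp [mul_add]
  map_smul' c a := by funext i; simp [smul_eq_mul]; ring

/-- Two codes are equivalent if one is obtained from the other by a permutation of the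
coordinates and multiplication of coordinates by nonzero scalars. -/
noncomputable def codeEquiv {n : ℕ} (C C' : Submodule F4 (Fin n → F4)) : Prop :=
  ∃ (σ : Equiv.Perm (Fin n)) (s : Fin n → F4),
    (∀ i, s i ≠ 0) ∧ Submodule.map (monoMap σ s) C = C'

/-- First row of the generator matrix `G(a₁, a₂, a₃, a₄, a₅)`. -/
noncomputable def row1 (n a₁ : ℕ) : Fin n → F4 := fun i =>
  if i.val = 0 then 1
  else if i.val < 2 + a₁ then 0
  else 1

/-- Second row of the generator matrix `G(a₁, a₂, a₃, a₄, a₅)`. -/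
noncomputable def row2 (n a₁ a₂ a₃ a₄ : ℕ) : Fin n → F4 := fun i =>
  if i.val = 0 then 0
  else if i.val < 2 + a₁ then 1
  else if i.val < 2 + a₁ + a₂ then 0
  else if i.val < 2 + a₁ + a₂ + a₃ then 1
  else if i.val < 2 + a₁ + a₂ + a₃ + a₄ then ω4
  else ω4 ^ 2

set_option linter.unusedVariables false in
/-- The code `C(a₁, a₂, a₃, a₄, a₅)`, of length `n = 2 + a₁ + a₂ + a₃ + a₄ + a₅`:
the span of the rows of the generator matrix `G(a₁, a₂, a₃, a₄, a₅)` whose columns are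
`(1,0)ᵀ`, `(0,1)ᵀ`, `a₁` columns `(0,1)ᵀ`, `a₂` columns `(1,0)ᵀ`, `a₃` columns `(1,1)ᵀ`,
`a₄` columns `(1,ω)ᵀ` and `a₅` columns `(1,ω²)ᵀ`. -/
noncomputable def Ccode (n a₁ a₂ a₃ a₄ a₅ : ℕ) : Submodule F4 (Fin n → F4) :=
  Submodule.span F4 {row1 n a₁, row2 n a₁ a₂ a₃ a₄}

/-- The largest minimum weight among Hermitian LCD `[n,2]` codes. -/
def optimalDist (n : ℕ) : ℕ :=
  if n % 5 = 1 ∨ n % 5 = 2 ∨ n % 5 = 3 then 4 * n / 5 else 4 * n / 5 - 1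

/-- `C` is an optimal Hermitian LCD `[n, 2, d]` code. -/
noncomputable def IsOptimalLCD (n d : ℕ) (C : Submodule F4 (Fin n → F4)) : Prop :=
  Module.finrank F4 C = 2 ∧ hasMinWeight C d ∧ IsHermLCD C ∧ d = optimalDist n

/-- The linear map appending a zero coordinate: `x ↦ (x, 0)`. -/
noncomputable def extendZero (m : ℕ) : (Fin m → F4) →ₗ[F4] (Fin (m + 1) → F4) where
  toFun x := Fin.snoc x 0
  map_add' a b := by
    funext i
    refine Fin.lastCases ?_ ?_ i <;> simp
  map_smul' c a := by
    funext i
    refine Fin.lastCases ?_ ?_ i <;> simp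

/-- The coordinate map that moves the columns of `G(a₁, a₂, b + 1, a₄, a₅)`, after its first row
is added to its second, to the positions they have in `G(a₁, b, a₂ + 1, a₅, a₄)`. -/
def columnIndex (a₁ a₂ b a₄ a₅ i : ℕ) : ℕ :=
  if i = 0 then 2 + a₁ + a₂
  else if i < 2 + a₁ then i
  else if i < 2 + a₁ + b then i + a₂ + 1
  else if i = 2 + a₁ + b then 0
  else if i < 2 + a₁ + a₂ + (b + 1) then i - (b + 1)
  else if i < 2 + a₁ + a₂ + (b + 1) + a₅ then i + a₄
  else i - a₅

lemma columnIndex_lt {a₁ a₂ b a₄ a₅ i : ℕ} (hi : i < 2 + a₁ + a₂ + (b + 1) + a₄ + a₅) :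
    columnIndex a₁ a₂ b a₄ a₅ i < 2 + a₁ + a₂ + (b + 1) + a₄ + a₅ := by
  unfold columnIndex
  split_ifs <;> omega

lemma columnIndex_inj {a₁ a₂ b a₄ a₅ i j : ℕ} (hi : i < 2 + a₁ + a₂ + (b + 1) + a₄ + a₅)
    (hj : j < 2 + a₁ + a₂ + (b + 1) + a₄ + a₅)
    (h : columnIndex a₁ a₂ b a₄ a₅ i = columnIndex a₁ a₂ b a₄ a₅ j) : i = j := by
  unfold columnIndex at h
  split_ifs at h <;> omega

/-- `columnIndex` as a permutation of the coordinates. -/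
noncomputable def columnPerm (a₁ a₂ b a₄ a₅ : ℕ) :
    Equiv.Perm (Fin (2 + a₁ + a₂ + (b + 1) + a₄ + a₅)) :=
  Equiv.ofBijective (fun i => ⟨columnIndex a₁ a₂ b a₄ a₅ i, columnIndex_lt i.isLt⟩)
    (Finite.injective_iff_bijective.mp fun i j h =>
      Fin.ext (columnIndex_inj i.isLt j.isLt (congrArg Fin.val h)))

lemma columnPerm_val (a₁ a₂ b a₄ a₅ : ℕ) (i : Fin (2 + a₁ + a₂ + (b + 1) + a₄ + a₅)) :
    (columnPerm a₁ a₂ b a₄ a₅ i).val = columnIndex a₁ a₂ b a₄ a₅ i := rfl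

lemma F4.one_add_one : (1 : F4) + 1 = 0 := CharTwo.add_self_eq_zero 1

lemma one_add_ω4 : 1 + ω4 = ω4 ^ 2 := by
  linear_combination (1 + ω4) * F4.one_add_one - ω4_spec

lemma one_add_ω4_sq : 1 + ω4 ^ 2 = ω4 := by
  linear_combination ω4_spec - ω4 * F4.one_add_one

lemma row1_columnPerm (a₁ a₂ b a₄ a₅ : ℕ) (i : Fin (2 + a₁ + a₂ + (b + 1) + a₄ + a₅)) :
    row1 _ a₁ (columnPerm a₁ a₂ b a₄ a₅ i) = row1 _ a₁ i := by
  have hi := i.isLt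
  simp only [row1, columnPerm_val, columnIndex]
  split_ifs <;> first | rfl | omega

set_option maxHeartbeats 1000000 in
lemma row1_add_row2_columnPerm (a₁ a₂ b a₄ a₅ : ℕ)
    (i : Fin (2 + a₁ + a₂ + (b + 1) + a₄ + a₅)) :
    row1 _ a₁ (columnPerm a₁ a₂ b a₄ a₅ i) + row2 _ a₁ a₂ (b + 1) a₄ (columnPerm a₁ a₂ b a₄ a₅ i) =
      row2 _ a₁ b (a₂ + 1) a₅ i := by
  have hi := i.isLt
  rw [row1_columnPerm]
  simp only [row1, row2, columnPerm_val, columnIndex]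
  split_ifs <;>
    first
    | contradiction
    | omega
    | simp only [F4.one_add_one, one_add_ω4, one_add_ω4_sq, add_zero, zero_add]

/-- Adding one generator to the other does not change the span of a pair. -/
lemma Submodule.span_pair_add_right {R M : Type*} [Ring R] [AddCommGroup M] [Module R M]
    (x y : M) : span R {x, x + y} = span R {x, y} := by
  apply le_antisymm <;> rw [span_le, Set.pair_subset_iff]
  · exact ⟨mem_span_pair.mpr ⟨1, 0, by simp⟩, mem_span_pair.mpr ⟨1, 1, by simp⟩⟩
  · exact ⟨mem_span_pair.mpr ⟨1, 0, by simp⟩, mem_span_pair.mpr ⟨-1, 1, by simp⟩⟩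

/-- if `a₃ ≥ 1` then `C(a₁, a₂, a₃, a₄, a₅)` is equivalent to
`C(a₁, a₃ - 1, a₂ + 1, a₅, a₄)`. -/
theorem stmt6 (a₁ a₂ a₃ a₄ a₅ : ℕ) (ha₃ : 1 ≤ a₃) :
    codeEquiv (Ccode (2 + a₁ + a₂ + a₃ + a₄ + a₅) a₁ a₂ a₃ a₄ a₅)
      (Ccode (2 + a₁ + a₂ + a₃ + a₄ + a₅) a₁ (a₃ - 1) (a₂ + 1) a₅ a₄) := by
  obtain ⟨b, rfl⟩ := Nat.exists_eq_add_of_le' ha₃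
  refine ⟨columnPerm a₁ a₂ b a₄ a₅, fun _ => 1, fun _ => one_ne_zero, ?_⟩
  rw [Ccode, Ccode, ← Submodule.span_pair_add_right, Submodule.map_span, Set.image_pair,
    Nat.add_sub_cancel]
  congr 2
  · funext i
    simpa [monoMap] using row1_columnPerm a₁ a₂ b a₄ a₅ i
  · congr 1
    funext i
    simpa [monoMap] using row1_add_row2_columnPerm a₁ a₂ b a₄ a₅ i
end

section
/- For every integer m ≥ 2, there exist exactly two equivalence classes of optimal Hermitian LCD quaternary [5m, 2, 4m−1] codes; that is, there exist optimal Hermitian LCD [5m, 2, 4m−1] codes C₁ and C₂ that are not equivalent, such that every optimal Hermitian LCD [5m, 2, 4m−1] code is equivalent to C₁ or to C₂. -/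
open Finset

namespace F4

lemma pow_four (x : F4) : x ^ 4 = x := by
  simpa [F4.card_eq] using FiniteField.pow_card x

lemma pow_three {x : F4} (hx : x ≠ 0) : x ^ 3 = 1 := by
  apply mul_left_cancel₀ hx
  rw [mul_one, ← pow_succ', pow_four]

lemma omega_sq : ω4 ^ 2 = ω4 + 1 := by
  have h := ω4_spec
  rw [add_assoc] at h
  exact CharTwo.add_eq_zero.mp h

lemma omega_ne_zero : ω4 ≠ 0 := by
  intro h
  simpa [h] using ω4_spec

lemma omega_ne_one : ω4 ≠ 1 := by
  intro h
  have := ω4_spec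
  simp [h, CharTwo.add_self_eq_zero] at this

lemma omega_add_one_ne_zero : ω4 + 1 ≠ 0 := fun h =>
  omega_ne_one (CharTwo.add_eq_zero.mp h)

lemma univ_eq [DecidableEq F4] : (univ : Finset F4) = {0, 1, ω4, ω4 + 1} := by
  symm
  apply Finset.eq_univ_of_card
  rw [F4.card_eq]
  have h0 := omega_ne_zero
  have h1 := omega_ne_one
  have h2 := omega_add_one_ne_zero
  rw [card_insert_of_notMem, card_insert_of_notMem, card_insert_of_notMem, card_singleton]
  · simp
  · simp [h1.symm, h0]
  · simp [h0.symm, h2.symm]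

lemma eq_cases (x : F4) : x = 0 ∨ x = 1 ∨ x = ω4 ∨ x = ω4 + 1 := by
  classical
  have h := mem_univ x
  rw [univ_eq] at h
  simpa using h

lemma sum_eq {M : Type*} [AddCommMonoid M] (f : F4 → M) :
    ∑ t, f t = f 0 + (f 1 + (f ω4 + f (ω4 + 1))) := by
  classical
  have h0 := omega_ne_zero
  have h1 := omega_ne_one
  have h2 := omega_add_one_ne_zero
  rw [univ_eq, sum_insert, sum_insert, sum_insert, sum_singleton]
  · simp
  · simp [h1.symm, h0]
  · simp [h0.symm, h2.symm]

lemma natCast_eq_ite (k : ℕ) : (k : F4) = if Odd k then 1 else 0 := by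
  split_ifs with h
  · exact (CharTwo.natCast_eq_ite k).trans (by simp [Nat.not_even_iff_odd.mpr h])
  · exact (CharTwo.natCast_eq_ite k).trans (by simp [Nat.not_odd_iff_even.mp h])

end F4

open scoped Classical in
/-- The number of zero coordinates of a vector. -/
noncomputable def zeroCount {n : ℕ} (x : Fin n → F4) : ℕ :=
  (univ.filter fun i => x i = 0).card

section Weight

variable {n : ℕ}

lemma zeroCount_add_wt (x : Fin n → F4) : zeroCount x + wt x = n := by
  classical
  have := card_filter_add_card_filter_not (s := (univ : Finset (Fin n))) (fun i => x i = 0)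
  simpa [zeroCount, wt] using this

lemma wt_smul {c : F4} (hc : c ≠ 0) (x : Fin n → F4) : wt (c • x) = wt x := by
  classical
  simp only [wt, Pi.smul_apply, smul_eq_mul, ne_eq, mul_eq_zero, hc, false_or]

lemma zeroCount_smul {c : F4} (hc : c ≠ 0) (x : Fin n → F4) :
    zeroCount (c • x) = zeroCount x := by
  classical
  simp only [zeroCount, Pi.smul_apply, smul_eq_mul, mul_eq_zero, hc, false_or]

lemma wt_monoMap (σ : Equiv.Perm (Fin n)) {s : Fin n → F4} (hs : ∀ i, s i ≠ 0)
    (x : Fin n → F4) : wt (monoMap σ s x) = wt x := by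
  classical
  unfold wt
  refine card_bij (fun i _ => σ i) ?_ (fun i _ j _ h => σ.injective h) ?_
  · intro i hi
    simpa [monoMap, hs] using hi
  · intro j hj
    exact ⟨σ.symm j, by simpa [monoMap, hs] using hj, by simp⟩

end Weight

section Hermitian

variable {n : ℕ}

lemma hermInner_self (x : Fin n → F4) : hermInner x x = (wt x : F4) := by
  classical
  unfold hermInner wt
  rw [card_filter, Nat.cast_sum]
  refine sum_congr rfl fun i _ => ?_
  by_cases h : x i = 0
  · simp [h]
  · simpa [h, ← pow_succ'] using F4.pow_three h

lemma hermInner_swap (x y : Fin n → F4) : hermInner y x = hermInner x y ^ 2 := by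
  unfold hermInner
  rw [CharTwo.sum_sq]
  refine sum_congr rfl fun i _ => ?_
  rw [mul_pow, ← pow_mul, F4.pow_four, mul_comm]

lemma hermInner_add_left (x y z : Fin n → F4) :
    hermInner (x + y) z = hermInner x z + hermInner y z := by
  simp [hermInner, add_mul, sum_add_distrib]

lemma hermInner_smul_left (c : F4) (x z : Fin n → F4) :
    hermInner (c • x) z = c * hermInner x z := by
  simp [hermInner, mul_sum, mul_assoc]

lemma hermInner_add_right (x y z : Fin n → F4) :
    hermInner z (x + y) = hermInner z x + hermInner z y := by
  rw [hermInner_swap, hermInner_add_left, CharTwo.add_sq, ← hermInner_swap, ← hermInner_swap]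

lemma hermInner_smul_right (c : F4) (x z : Fin n → F4) :
    hermInner z (c • x) = c ^ 2 * hermInner z x := by
  rw [hermInner_swap, hermInner_smul_left, mul_pow, ← hermInner_swap]

end Hermitian

/-- Representatives, up to scalars, of the nonzero words of the code spanned by `a` and `b`. -/
noncomputable def word {n : ℕ} (a b : Fin n → F4) : Option F4 → Fin n → F4
  | none => a
  | some t => b + t • a

/-- The label of a nonzero column `(x, y)`: the index of the word vanishing on it. -/
noncomputable def colLabel (x y : F4) : Option F4 :=
  open scoped Classical in if x = 0 then none else some (y / x)

section Words

variable {n : ℕ} {a b : Fin n → F4}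

lemma word_mem_span (a b : Fin n → F4) (P : Option F4) :
    word a b P ∈ Submodule.span F4 {a, b} := by
  rw [Submodule.mem_span_pair]
  cases P with
  | none => exact ⟨1, 0, by simp [word]⟩
  | some t => exact ⟨t, 1, by simp [word, add_comm]⟩

lemma exists_smul_word {x : Fin n → F4} (hx : x ∈ Submodule.span F4 {a, b}) (hx0 : x ≠ 0) :
    ∃ (c : F4) (P : Option F4), c ≠ 0 ∧ x = c • word a b P := by
  obtain ⟨p, q, rfl⟩ := Submodule.mem_span_pair.mp hx
  by_cases hq : q = 0
  · refine ⟨p, none, ?_, by simp [word, hq]⟩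
    rintro rfl
    simp [hq] at hx0
  · refine ⟨q, some (p / q), hq, ?_⟩
    simp [word, smul_smul, mul_div_cancel₀ _ hq, add_comm]

lemma linearIndependent_of_word_ne_zero (h : ∀ P, word a b P ≠ 0) :
    LinearIndependent F4 ![a, b] := by
  rw [LinearIndependent.pair_iff]
  intro p q hpq
  by_cases hq : q = 0
  · subst hq
    have : p = 0 ∨ a = 0 := by simpa using hpq
    exact ⟨this.resolve_right (h none), rfl⟩
  · refine absurd ?_ (h (some (p / q)))
    have : q • word a b (some (p / q)) = 0 := by
      rw [← hpq]
      simp [word, smul_smul, mul_div_cancel₀ _ hq, add_comm]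
    exact (smul_eq_zero.mp this).resolve_left hq

lemma linearIndependent_word (h : LinearIndependent F4 ![a, b]) {P Q : Option F4} (hPQ : P ≠ Q) :
    LinearIndependent F4 ![word a b P, word a b Q] := by
  rw [LinearIndependent.pair_iff] at h ⊢
  intro p q hpq
  cases P with
  | none =>
    cases Q with
    | none => exact absurd rfl hPQ
    | some t =>
      obtain ⟨h1, h2⟩ := h (p + q * t) q (by rw [← hpq]; simp only [word]; module)
      subst h2
      simpa using h1
  | some s =>
    cases Q with
    | none =>
      obtain ⟨h1, h2⟩ := h (q + p * s) p (by rw [← hpq]; simp only [word]; module)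
      subst h2
      simpa using h1
    | some t =>
      obtain ⟨h1, h2⟩ := h (p * s + q * t) (p + q) (by rw [← hpq]; simp only [word]; module)
      have hst : s - t ≠ 0 := sub_ne_zero.mpr fun e => hPQ (by rw [e])
      have hp : p = 0 := by
        have : p * (s - t) = 0 := by linear_combination h1 - t * h2
        exact (mul_eq_zero.mp this).resolve_right hst
      subst hp
      simpa using h2

lemma finrank_span_pair_eq_two (h : LinearIndependent F4 ![a, b]) :
    Module.finrank F4 (Submodule.span F4 {a, b}) = 2 := by
  rw [← Matrix.range_cons_cons_empty a b ![], finrank_span_eq_card h, Fintype.card_fin]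

lemma exists_eq_span_pair {C : Submodule F4 (Fin n → F4)} (hC : Module.finrank F4 C = 2) :
    ∃ a b, LinearIndependent F4 ![a, b] ∧ C = Submodule.span F4 {a, b} := by
  let B := Module.finBasisOfFinrankEq F4 C hC
  have hli : LinearIndependent F4 ![(B 0 : Fin n → F4), B 1] := by
    have := B.linearIndependent.map' C.subtype C.ker_subtype
    rwa [show ⇑C.subtype ∘ ⇑B = ![(B 0 : Fin n → F4), B 1] by
      funext i
      fin_cases i <;> rfl] at this
  refine ⟨B 0, B 1, hli, ?_⟩
  refine (Submodule.eq_of_le_of_finrank_eq ?_ ?_).symm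
  · rw [Submodule.span_le]
    rintro x (rfl | rfl) <;> exact Subtype.property _
  · rw [hC, finrank_span_pair_eq_two hli]

lemma exists_rebase (h : LinearIndependent F4 ![a, b]) {P Q R : Option F4}
    (hPQ : P ≠ Q) (hPR : P ≠ R) (hQR : Q ≠ R) :
    ∃ u v, LinearIndependent F4 ![u, v] ∧
      Submodule.span F4 {a, b} = Submodule.span F4 {u, v} ∧
      zeroCount (word u v none) = zeroCount (word a b P) ∧
      zeroCount (word u v (some 0)) = zeroCount (word a b Q) ∧
      zeroCount (word u v (some 1)) = zeroCount (word a b R) := by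
  have key : ∀ {x y : Fin n → F4}, LinearIndependent F4 ![x, y] →
      x ∈ Submodule.span F4 {a, b} → y ∈ Submodule.span F4 {a, b} →
      Submodule.span F4 {x, y} = Submodule.span F4 {a, b} := by
    intro x y hxy hx hy
    refine Submodule.eq_of_le_of_finrank_eq ?_ ?_
    · rw [Submodule.span_le]
      rintro z (rfl | rfl) <;> assumption
    · rw [finrank_span_pair_eq_two h, finrank_span_pair_eq_two hxy]
  have hR := word_mem_span a b R
  rw [← key (linearIndependent_word h hPQ) (word_mem_span a b P) (word_mem_span a b Q),
    Submodule.mem_span_pair] at hR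
  obtain ⟨p, q, hpq⟩ := hR
  have hp : p ≠ 0 := by
    rintro rfl
    have := (LinearIndependent.pair_iff.mp (linearIndependent_word h hQR)) q (-1)
      (by rw [← hpq]; module)
    simp at this
  have hq : q ≠ 0 := by
    rintro rfl
    have := (LinearIndependent.pair_iff.mp (linearIndependent_word h hPR)) p (-1)
      (by rw [← hpq]; module)
    simp at this
  have hli : LinearIndependent F4 ![p • word a b P, q • word a b Q] := by
    rw [LinearIndependent.pair_iff]
    intro s t hst
    obtain ⟨h1, h2⟩ := (LinearIndependent.pair_iff.mp (linearIndependent_word h hPQ)) (s * p)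
      (t * q) (by rw [← hst]; module)
    exact ⟨(mul_eq_zero.mp h1).resolve_right hp, (mul_eq_zero.mp h2).resolve_right hq⟩
  refine ⟨_, _, hli, (key hli ?_ ?_).symm, ?_, ?_, ?_⟩
  · exact Submodule.smul_mem _ _ (word_mem_span a b P)
  · exact Submodule.smul_mem _ _ (word_mem_span a b Q)
  · exact zeroCount_smul hp _
  · simpa [word] using zeroCount_smul hq (word a b Q)
  · rw [← hpq]
    simp [word, add_comm]

lemma word_apply_eq_zero_iff {i : Fin n} (h : ¬ (a i = 0 ∧ b i = 0)) (P : Option F4) :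
    word a b P i = 0 ↔ colLabel (a i) (b i) = P := by
  cases P with
  | none => simp [word, colLabel]
  | some t =>
    by_cases ha : a i = 0
    · simp [word, colLabel, ha] at h ⊢
      exact h
    · simp [word, colLabel, ha, CharTwo.add_eq_zero, div_eq_iff ha]

open scoped Classical in
lemma sum_zeroCount_word (a b : Fin n → F4) :
    ∑ P, zeroCount (word a b P) = n + 4 * (univ.filter fun i => a i = 0 ∧ b i = 0).card := by
  simp only [zeroCount, card_filter]
  rw [sum_comm, mul_sum]
  trans ∑ i, (1 + 4 * if a i = 0 ∧ b i = 0 then 1 else 0)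
  swap
  · simp [sum_add_distrib]
  refine sum_congr rfl fun i _ => ?_
  by_cases h : a i = 0 ∧ b i = 0
  · rw [if_pos h, Fintype.sum_option]
    simp [word, h.1, h.2, F4.card_eq]
  · simp [word_apply_eq_zero_iff h, h]

lemma codeEquiv_of_zeroCount_word_eq {a' b' : Fin n → F4}
    (h : ∀ i, ¬ (a i = 0 ∧ b i = 0)) (h' : ∀ i, ¬ (a' i = 0 ∧ b' i = 0))
    (hz : ∀ P, zeroCount (word a b P) = zeroCount (word a' b' P)) :
    codeEquiv (Submodule.span F4 {a, b}) (Submodule.span F4 {a', b'}) := by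
  classical
  have hcard : ∀ P, Nonempty ({i // colLabel (a' i) (b' i) = P} ≃
      {i // colLabel (a i) (b i) = P}) := by
    intro P
    rw [← Fintype.card_eq, Fintype.card_subtype, Fintype.card_subtype]
    simpa [zeroCount, word_apply_eq_zero_iff (h _), word_apply_eq_zero_iff (h' _)]
      using (hz P).symm
  let σ : Equiv.Perm (Fin n) := Equiv.ofFiberEquiv fun P => (hcard P).some
  have hσ : ∀ i, colLabel (a (σ i)) (b (σ i)) = colLabel (a' i) (b' i) := fun i =>
    Equiv.ofFiberEquiv_map (g := fun i => colLabel (a i) (b i)) (fun P => (hcard P).some) i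
  have hs : ∀ i, ∃ s : F4, s ≠ 0 ∧ s * a (σ i) = a' i ∧ s * b (σ i) = b' i := by
    intro i
    have h1 := hσ i
    have h2 := h (σ i)
    have h3 := h' i
    by_cases ha : a (σ i) = 0
    · by_cases ha' : a' i = 0
      · have hb : b (σ i) ≠ 0 := fun e => h2 ⟨ha, e⟩
        have hb' : b' i ≠ 0 := fun e => h3 ⟨ha', e⟩
        exact ⟨b' i / b (σ i), div_ne_zero hb' hb, by simp [ha, ha'], div_mul_cancel₀ _ hb⟩
      · simp [colLabel, ha, ha'] at h1
    · by_cases ha' : a' i = 0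
      · simp [colLabel, ha, ha'] at h1
      · simp only [colLabel, ha, ha', if_false, Option.some.injEq] at h1
        refine ⟨a' i / a (σ i), div_ne_zero ha' ha, div_mul_cancel₀ _ ha, ?_⟩
        field_simp at h1 ⊢
        rw [← h1, mul_comm]
  choose s hs0 hsa hsb using hs
  refine ⟨σ, s, hs0, ?_⟩
  rw [Submodule.map_span, Set.image_pair]
  rw [show monoMap σ s a = a' from funext hsa, show monoMap σ s b = b' from funext hsb]

end Words

section LCD

variable {n : ℕ} {a b : Fin n → F4}

lemma mem_hermDual_span_pair {x : Fin n → F4} :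
    x ∈ hermDual (Submodule.span F4 {a, b}) ↔ hermInner x a = 0 ∧ hermInner x b = 0 := by
  refine ⟨fun h => ⟨h a (Submodule.subset_span (by simp)),
    h b (Submodule.subset_span (by simp))⟩, fun h y hy => ?_⟩
  obtain ⟨p, q, rfl⟩ := Submodule.mem_span_pair.mp hy
  simp [hermInner_add_right, hermInner_smul_right, h.1, h.2]

lemma isHermLCD_span_pair_iff (h : LinearIndependent F4 ![a, b]) :
    IsHermLCD (Submodule.span F4 {a, b}) ↔ (wt a : F4) * wt b ≠ hermInner a b ^ 3 := by
  have hdual : ∀ p q : F4, p • a + q • b ∈ hermDual (Submodule.span F4 {a, b}) ↔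
      p * wt a + q * hermInner a b ^ 2 = 0 ∧ p * hermInner a b + q * wt b = 0 := by
    intro p q
    rw [mem_hermDual_span_pair]
    simp only [hermInner_add_left, hermInner_smul_left, hermInner_self, hermInner_swap a b]
  rw [LinearIndependent.pair_iff] at h
  unfold IsHermLCD
  constructor
  · intro hC hdet
    have hzero : ∀ p q : F4, p * wt a + q * hermInner a b ^ 2 = 0 →
        p * hermInner a b + q * wt b = 0 → p = 0 ∧ q = 0 := by
      intro p q h1 h2
      apply h
      rw [← Submodule.mem_bot F4, ← hC]
      exact ⟨Submodule.mem_span_pair.mpr ⟨p, q, rfl⟩, (hdual p q).mpr ⟨h1, h2⟩⟩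
    obtain ⟨hc, ha⟩ := hzero (hermInner a b ^ 2) (wt a)
      (by rw [mul_comm]; exact CharTwo.add_self_eq_zero _)
      (by rw [hdet, ← pow_succ]; exact CharTwo.add_self_eq_zero _)
    have hc' := pow_eq_zero_iff (two_ne_zero) |>.mp hc
    simpa using hzero 1 0 (by simp [ha]) (by simp [hc'])
  · intro hdet
    rw [Submodule.eq_bot_iff]
    rintro x ⟨hx, hx'⟩
    obtain ⟨p, q, rfl⟩ := Submodule.mem_span_pair.mp hx
    obtain ⟨h1, h2⟩ := (hdual p q).mp hx'
    have hdet' := sub_ne_zero.mpr hdet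
    have hp : p = 0 := by
      refine (mul_eq_zero.mp ?_).resolve_right hdet'
      linear_combination (wt b : F4) * h1 - hermInner a b ^ 2 * h2
    have hq : q = 0 := by
      refine (mul_eq_zero.mp ?_).resolve_right hdet'
      linear_combination (wt a : F4) * h2 - hermInner a b * h1
    simp [hp, hq]

lemma natCast_wt_word_some {t : F4} (ht : t ≠ 0) :
    (wt (word a b (some t)) : F4) =
      wt a + wt b + (t * hermInner a b + (t * hermInner a b) ^ 2) := by
  rw [← hermInner_self, word, hermInner_add_left, hermInner_add_right, hermInner_add_right]
  simp only [hermInner_smul_left, hermInner_smul_right, hermInner_self, hermInner_swap a b, wt_smul ht]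
  ring

open scoped Classical in
lemma card_odd_wt_word_eq_two_iff :
    (univ.filter fun P => Odd (wt (word a b P))).card = 2 ↔
      (wt a : F4) * wt b ≠ hermInner a b ^ 3 := by
  have hodd : ∀ k : ℕ, Odd k ↔ (k : F4) = 1 := fun k => by
    rw [F4.natCast_eq_ite]
    split_ifs with h <;> simp [h]
  have h01 : ∀ k : ℕ, (k : F4) = 0 ∨ (k : F4) = 1 := fun k => by
    rw [F4.natCast_eq_ite]
    split_ifs <;> simp
  have hadd : ∀ x : F4, x + x = 0 := CharTwo.add_self_eq_zero
  have e1 : ω4 * ω4 = ω4 + 1 := by rw [← sq, F4.omega_sq]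
  have e2 : ω4 * (ω4 + 1) = 1 := by rw [mul_add, e1, mul_one, add_right_comm, hadd, zero_add]
  have e3 : (ω4 + 1) * (ω4 + 1) = ω4 := by
    rw [add_mul, e2, one_mul, add_comm, add_assoc, hadd, add_zero]
  have e4 : (ω4 + 1) * ω4 = 1 := by rw [mul_comm, e2]
  have e5 : ω4 + (ω4 + 1) = 1 := by rw [← add_assoc, hadd, zero_add]
  have e6 : ω4 + 1 + ω4 = 1 := by rw [add_comm, e5]
  have h3 := F4.pow_three F4.omega_ne_zero
  have h4 := F4.pow_three F4.omega_add_one_ne_zero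
  rw [card_filter, Fintype.sum_option, F4.sum_eq]
  simp only [hodd, natCast_wt_word_some one_ne_zero, natCast_wt_word_some F4.omega_ne_zero,
    natCast_wt_word_some F4.omega_add_one_ne_zero]
  simp only [word, zero_smul, add_zero]
  rcases h01 (wt a) with hA | hA <;> rcases h01 (wt b) with hB | hB <;>
    rcases F4.eq_cases (hermInner a b) with hc | hc | hc | hc <;>
    simp [hA, hB, hc, hadd, sq, e1, e2, e3, e4, e5, e6, h3, h4]

end LCD

section Multiplicities

/-- The zero counts `p`, `q`, `r`, `s`, `s` of the five words of a code. -/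
noncomputable def zeroProfile (p q r s : ℕ) : Option F4 → ℕ
  | none => p
  | some t => open scoped Classical in if t = 0 then q else if t = 1 then r else s

lemma sum_option_F4 (f : Option F4 → ℕ) :
    ∑ P, f P = f none + (f (some 0) + (f (some 1) + (f (some ω4) + f (some (ω4 + 1))))) := by
  rw [Fintype.sum_option, F4.sum_eq]

lemma card_option_F4 : Fintype.card (Option F4) = 5 := by
  rw [Fintype.card_option, F4.card_eq]

variable (p q r s : ℕ)

@[simp] lemma zeroProfile_none : zeroProfile p q r s none = p := rfl

@[simp] lemma zeroProfile_zero : zeroProfile p q r s (some 0) = q := by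
  simp [zeroProfile]

@[simp] lemma zeroProfile_one : zeroProfile p q r s (some 1) = r := by
  simp [zeroProfile]

@[simp] lemma zeroProfile_omega : zeroProfile p q r s (some ω4) = s := by
  simp [zeroProfile, F4.omega_ne_zero, F4.omega_ne_one]

@[simp] lemma zeroProfile_omega_add_one : zeroProfile p q r s (some (ω4 + 1)) = s := by
  simp [zeroProfile, F4.omega_ne_zero, F4.omega_add_one_ne_zero]

lemma forall_option_F4 {p : Option F4 → Prop} :
    (∀ P, p P) ↔ p none ∧ p (some 0) ∧ p (some 1) ∧ p (some ω4) ∧ p (some (ω4 + 1)) := by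
  refine ⟨fun h => ⟨h _, h _, h _, h _, h _⟩, fun ⟨h1, h2, h3, h4, h5⟩ P => ?_⟩
  rcases P with _ | t
  · exact h1
  · rcases F4.eq_cases t with rfl | rfl | rfl | rfl <;> assumption

lemma exists_deficits {ι : Type*} [Fintype ι] (hι : Fintype.card ι = 5) (d : ι → ℕ)
    (hsum : ∑ i, d i = 5) (heven : (univ.filter fun i => Even (d i)).card = 2) :
    ∃ i j k, i ≠ j ∧ i ≠ k ∧ j ≠ k ∧
      (d i = 3 ∧ d j = 1 ∧ d k = 1 ∨ d i = 2 ∧ d j = 0 ∧ d k = 1) := by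
  classical
  have hodd : (univ.filter fun i => ¬ Even (d i)).card = 3 := by
    have := card_filter_add_card_filter_not (s := (univ : Finset ι)) (fun i => Even (d i))
    rw [card_univ, hι] at this
    omega
  have hsplit := sum_filter_add_sum_filter_not univ (fun i => Even (d i)) d
  obtain ⟨e, e', hee', he⟩ := card_eq_two.mp heven
  obtain ⟨x, y, z, hxy, hxz, hyz, ho⟩ := card_eq_three.mp hodd
  have heven' : ∀ i, i ∈ ({e, e'} : Finset ι) → d i % 2 = 0 := fun i hi => by
    rw [← he] at hi
    exact Nat.even_iff.mp (mem_filter.mp hi).2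
  have hodd' : ∀ i, i ∈ ({x, y, z} : Finset ι) → d i % 2 = 1 := fun i hi => by
    rw [← ho] at hi
    exact Nat.not_even_iff.mp (mem_filter.mp hi).2
  have h1 := heven' e (by simp)
  have h2 := heven' e' (by simp)
  have h3 := hodd' x (by simp)
  have h4 := hodd' y (by simp)
  have h5 := hodd' z (by simp)
  rw [he, ho, sum_pair hee', sum_insert (by simp [hxy, hxz]), sum_pair hyz, hsum] at hsplit
  have hne : ∀ {i j}, d i % 2 = 0 → d j % 2 = 1 → i ≠ j := by
    rintro i j hi hj rfl
    omega
  have hcases : (d x = 3 ∧ d y = 1 ∧ d z = 1) ∨ (d y = 3 ∧ d x = 1 ∧ d z = 1) ∨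
      (d z = 3 ∧ d x = 1 ∧ d y = 1) ∨ (d e = 2 ∧ d e' = 0 ∧ d x = 1) ∨
      (d e' = 2 ∧ d e = 0 ∧ d x = 1) := by
    omega
  rcases hcases with h | h | h | h | h
  · exact ⟨x, y, z, hxy, hxz, hyz, Or.inl h⟩
  · exact ⟨y, x, z, hxy.symm, hyz, hxz, Or.inl h⟩
  · exact ⟨z, x, y, hxz.symm, hyz.symm, hxy, Or.inl h⟩
  · exact ⟨e, e', x, hee', hne h1 h3, hne h2 h3, Or.inr h⟩
  · exact ⟨e', e, x, hee'.symm, hne h2 h3, hne h1 h3, Or.inr h⟩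

end Multiplicities

section Optimal

variable {m : ℕ}

open scoped Classical in
lemma exists_deficits_of_isOptimalLCD (hm : 0 < m) {a b : Fin (5 * m) → F4}
    (h : LinearIndependent F4 ![a, b])
    (hopt : IsOptimalLCD (5 * m) (4 * m - 1) (Submodule.span F4 {a, b})) :
    ∃ d : Option F4 → ℕ, (∀ P, zeroCount (word a b P) + d P = m + 1) ∧ ∑ P, d P = 5 ∧
      (univ.filter fun P => Even (d P)).card = 2 ∧ ∀ i, ¬ (a i = 0 ∧ b i = 0) := by
  obtain ⟨-, ⟨hmin, -⟩, hlcd, -⟩ := hopt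
  rw [isHermLCD_span_pair_iff h, ← card_odd_wt_word_eq_two_iff] at hlcd
  have hle : ∀ P, zeroCount (word a b P) ≤ m + 1 := fun P => by
    have hne : word a b P ≠ 0 := by
      obtain ⟨Q, hQ⟩ := exists_ne P
      exact (linearIndependent_word h hQ.symm).ne_zero 0
    have := hmin _ (word_mem_span a b P) hne
    have := zeroCount_add_wt (word a b P)
    omega
  have hd : ∀ P, zeroCount (word a b P) + (m + 1 - zeroCount (word a b P)) = m + 1 := fun P =>
    Nat.add_sub_cancel' (hle P)
  have heven : (univ.filter fun P => Even (m + 1 - zeroCount (word a b P))).card = 2 := by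
    rw [← hlcd]
    congr 1
    refine filter_congr fun P _ => ?_
    have := zeroCount_add_wt (word a b P)
    have := hle P
    rw [Nat.even_iff, Nat.odd_iff]
    omega
  have hsum := sum_congr (rfl : (univ : Finset (Option F4)) = univ) fun P _ => hd P
  rw [sum_add_distrib, sum_zeroCount_word, sum_const, card_univ, card_option_F4,
    smul_eq_mul] at hsum
  have hge : 3 ≤ ∑ P, (m + 1 - zeroCount (word a b P)) := by
    have hodd := card_filter_add_card_filter_not (s := (univ : Finset (Option F4)))
      (fun P => Even (m + 1 - zeroCount (word a b P)))
    rw [card_univ, card_option_F4, heven] at hodd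
    have : (univ.filter fun P => ¬ Even (m + 1 - zeroCount (word a b P))).card ≤
        ∑ P, (m + 1 - zeroCount (word a b P)) := by
      rw [card_filter]
      refine sum_le_sum fun P _ => ?_
      split_ifs with hP
      · exact Nat.zero_le _
      · exact (Nat.not_even_iff_odd.mp hP).pos
    omega
  refine ⟨_, hd, by omega, heven, ?_⟩
  have hzero : (univ.filter fun i => a i = 0 ∧ b i = 0).card = 0 := by omega
  intro i hi
  exact (filter_eq_empty_iff.mp (card_eq_zero.mp hzero)) (mem_univ i) hi

lemma exists_basis_of_isOptimalLCD (hm : 2 ≤ m) {C : Submodule F4 (Fin (5 * m) → F4)}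
    (hC : IsOptimalLCD (5 * m) (4 * m - 1) C) :
    ∃ u v, C = Submodule.span F4 {u, v} ∧ (∀ i, ¬ (u i = 0 ∧ v i = 0)) ∧
      ((∀ P, zeroCount (word u v P) = zeroProfile (m - 2) m m (m + 1) P) ∨
        ∀ P, zeroCount (word u v P) = zeroProfile (m - 1) (m + 1) m m P) := by
  classical
  obtain ⟨a, b, hab, rfl⟩ := exists_eq_span_pair hC.1
  obtain ⟨d, hd, hsum, heven, -⟩ := exists_deficits_of_isOptimalLCD (by omega) hab hC
  obtain ⟨P, Q, R, hPQ, hPR, hQR, h⟩ := exists_deficits card_option_F4 d hsum heven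
  obtain ⟨u, v, huv, hspan, hP, hQ, hR⟩ := exists_rebase hab hPQ hPR hQR
  rw [hspan] at hC
  obtain ⟨d', hd', hsum', heven', hcol⟩ := exists_deficits_of_isOptimalLCD (by omega) huv hC
  refine ⟨u, v, hspan, hcol, ?_⟩
  have hdP := hd P
  have hdQ := hd Q
  have hdR := hd R
  obtain ⟨h1, h2, h3, h4, h5⟩ := forall_option_F4.mp hd'
  rw [sum_option_F4] at hsum'
  rcases h with h | h
  · left
    rw [forall_option_F4]
    simp only [zeroProfile_none, zeroProfile_zero, zeroProfile_one, zeroProfile_omega,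
      zeroProfile_omega_add_one]
    omega
  · right
    have e1 : Even (d' none) := ⟨1, by omega⟩
    have e2 : Even (d' (some 0)) := ⟨0, by omega⟩
    have e3 : ¬ Even (d' (some 1)) := by rw [Nat.even_iff]; omega
    rw [card_filter, sum_option_F4, if_pos e1, if_pos e2, if_neg e3] at heven'
    have e4 : ¬ Even (d' (some ω4)) := fun e => by
      rw [if_pos e] at heven'
      omega
    rw [Nat.even_iff] at e4
    rw [forall_option_F4]
    simp only [zeroProfile_none, zeroProfile_zero, zeroProfile_one, zeroProfile_omega,
      zeroProfile_omega_add_one]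
    omega

lemma exists_zeroCount_word_eq {n : ℕ} (N : Option F4 → ℕ) (hN : ∑ P, N P = n) :
    ∃ a b : Fin n → F4, (∀ i, ¬ (a i = 0 ∧ b i = 0)) ∧
      ∀ P, zeroCount (word a b P) = N P := by
  classical
  have hcard : Fintype.card (Fin n) = Fintype.card (Σ P, Fin (N P)) := by simp [hN]
  let e := Fintype.equivOfCardEq hcard
  let l : Fin n → Option F4 := fun i => (e i).1
  have hl : ∀ P, (univ.filter fun i => l i = P).card = N P := fun P => by
    rw [← Fintype.card_subtype]
    have e' : {i // l i = P} ≃ Fin (N P) :=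
      (e.subtypeEquiv fun i => Iff.rfl).trans (Equiv.sigmaSubtype P)
    rw [Fintype.card_congr e', Fintype.card_fin]
  let a : Fin n → F4 := fun i => (l i).elim 0 fun _ => 1
  let b : Fin n → F4 := fun i => (l i).elim 1 id
  have hcol : ∀ i, ¬ (a i = 0 ∧ b i = 0) := by
    intro i
    simp only [a, b]
    cases l i <;> simp
  have hlabel : ∀ i, colLabel (a i) (b i) = l i := by
    intro i
    simp only [a, b]
    cases l i <;> simp [colLabel]
  refine ⟨a, b, hcol, fun P => ?_⟩
  rw [← hl P]
  unfold zeroCount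
  congr 1
  refine filter_congr fun i _ => ?_
  rw [word_apply_eq_zero_iff (hcol i), hlabel]

open scoped Classical in
lemma isOptimalLCD_span_pair (hm : 0 < m) {a b : Fin (5 * m) → F4} {N : Option F4 → ℕ}
    (hN : ∀ P, zeroCount (word a b P) = N P) (hle : ∀ P, N P ≤ m + 1) (hmax : ∃ P, N P = m + 1)
    (hodd : (univ.filter fun P => Odd (5 * m - N P)).card = 2) :
    IsOptimalLCD (5 * m) (4 * m - 1) (Submodule.span F4 {a, b}) := by
  have hwt : ∀ P, wt (word a b P) = 5 * m - N P := fun P => by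
    rw [← hN P]
    exact (Nat.sub_eq_of_eq_add' (zeroCount_add_wt _).symm).symm
  have hmin : ∀ P, 4 * m - 1 ≤ wt (word a b P) := fun P => by
    have := hle P
    rw [hwt]
    omega
  have hne : ∀ P, word a b P ≠ 0 := fun P h0 => by
    have := hmin P
    rw [h0] at this
    simp [wt] at this
    omega
  have hli := linearIndependent_of_word_ne_zero hne
  refine ⟨finrank_span_pair_eq_two hli, ⟨?_, ?_⟩, ?_, ?_⟩
  · intro x hx hx0
    obtain ⟨c, P, hc, rfl⟩ := exists_smul_word hx hx0
    rw [wt_smul hc]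
    exact hmin P
  · obtain ⟨P, hP⟩ := hmax
    exact ⟨word a b P, word_mem_span a b P, hne P, by rw [hwt, hP]; omega⟩
  · rw [isHermLCD_span_pair_iff hli, ← card_odd_wt_word_eq_two_iff, ← hodd]
    simp only [hwt]
  · have : 5 * m % 5 = 0 := Nat.mul_mod_right 5 m
    unfold optimalDist
    rw [if_neg (by omega)]
    omega

lemma not_codeEquiv_of_zeroCount_word {n : ℕ} {a b a' b' : Fin n → F4} {P : Option F4}
    (hP : ∀ Q, zeroCount (word a b P) ≠ zeroCount (word a' b' Q)) (h0 : word a b P ≠ 0) :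
    ¬ codeEquiv (Submodule.span F4 {a, b}) (Submodule.span F4 {a', b'}) := by
  rintro ⟨σ, s, hs, hmap⟩
  have hx : monoMap σ s (word a b P) ∈ Submodule.span F4 {a', b'} :=
    hmap ▸ Submodule.mem_map_of_mem (word_mem_span a b P)
  have hw := wt_monoMap σ hs (word a b P)
  have hx0 : monoMap σ s (word a b P) ≠ 0 := fun h => by
    refine h0 (funext fun i => ?_)
    have := congrFun h (σ.symm i)
    simpa [monoMap, hs] using this
  obtain ⟨c, Q, hc, hcQ⟩ := exists_smul_word hx hx0
  rw [hcQ, wt_smul hc] at hw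
  have h1 := zeroCount_add_wt (word a b P)
  have h2 := zeroCount_add_wt (word a' b' Q)
  exact hP Q (by omega)

end Optimal

/-- for `m ≥ 2` there are exactly two equivalence classes of optimal
Hermitian LCD `[5m, 2, 4m - 1]` codes. -/
theorem stmt9 (m : ℕ) (hm : 2 ≤ m) :
    ∃ C₁ C₂ : Submodule F4 (Fin (5 * m) → F4),
      IsOptimalLCD (5 * m) (4 * m - 1) C₁ ∧ IsOptimalLCD (5 * m) (4 * m - 1) C₂ ∧
      ¬ codeEquiv C₁ C₂ ∧
      ∀ C : Submodule F4 (Fin (5 * m) → F4), IsOptimalLCD (5 * m) (4 * m - 1) C →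
        (codeEquiv C C₁ ∨ codeEquiv C C₂) := by
  classical
  obtain ⟨a, b, hab, hN⟩ := exists_zeroCount_word_eq (n := 5 * m)
    (zeroProfile (m - 2) m m (m + 1)) (by
      simp only [sum_option_F4, zeroProfile_none, zeroProfile_zero, zeroProfile_one,
        zeroProfile_omega, zeroProfile_omega_add_one]
      omega)
  obtain ⟨a', b', hab', hN'⟩ := exists_zeroCount_word_eq (n := 5 * m)
    (zeroProfile (m - 1) (m + 1) m m) (by
      simp only [sum_option_F4, zeroProfile_none, zeroProfile_zero, zeroProfile_one,
        zeroProfile_omega, zeroProfile_omega_add_one]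
      omega)
  refine ⟨Submodule.span F4 {a, b}, Submodule.span F4 {a', b'}, ?_, ?_, ?_, ?_⟩
  · refine isOptimalLCD_span_pair (by omega) hN ?_ ⟨some ω4, by simp⟩ ?_
    · rw [forall_option_F4]
      simp
      omega
    · have h1 : ¬ Odd (5 * m - (m - 2)) := by rw [Nat.odd_iff]; omega
      have h2 : ¬ Odd (5 * m - m) := by rw [Nat.odd_iff]; omega
      have h3 : Odd (5 * m - (m + 1)) := by rw [Nat.odd_iff]; omega
      rw [card_filter, sum_option_F4]
      simp [h1, h2, h3]
  · refine isOptimalLCD_span_pair (by omega) hN' ?_ ⟨some 0, by simp⟩ ?_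
    · rw [forall_option_F4]
      simp
      omega
    · have h1 : Odd (5 * m - (m - 1)) := by rw [Nat.odd_iff]; omega
      have h2 : ¬ Odd (5 * m - m) := by rw [Nat.odd_iff]; omega
      have h3 : Odd (5 * m - (m + 1)) := by rw [Nat.odd_iff]; omega
      rw [card_filter, sum_option_F4]
      simp [h1, h2, h3]
  · refine not_codeEquiv_of_zeroCount_word (P := none) ?_ fun h0 => ?_
    · simp only [hN, hN', forall_option_F4, zeroProfile_none, zeroProfile_zero,
        zeroProfile_one, zeroProfile_omega, zeroProfile_omega_add_one]
      omega
    · have := hN none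
      rw [h0] at this
      simp [zeroCount] at this
      omega
  · intro C hC
    obtain ⟨u, v, rfl, hcol, h | h⟩ := exists_basis_of_isOptimalLCD hm hC
    · exact Or.inl (codeEquiv_of_zeroCount_word_eq hcol hab fun P => by rw [h, hN])
    · exact Or.inr (codeEquiv_of_zeroCount_word_eq hcol hab' fun P => by rw [h, hN'])
end

section
/- For every integer m ≥ 3, there exist exactly six equivalence classes of optimal Hermitian LCD quaternary [5m+4, 2, 4m+2] codes; that is, there exist optimal Hermitian LCD [5m+4, 2, 4m+2] codes C₁, …, C₆, pairwise inequivalent, such that every optimal Hermitian LCD [5m+4, 2, 4m+2] code is equivalent to some Cᵢ. Moreover, exactly one of these six equivalence classes consists of codes whose Hermitian dual code has minimum weight 1. -/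
open Finset

lemma two_eq_zero_F4 : (2 : F4) = 0 := CharTwo.two_eq_zero

lemma ω4_sq : ω4 ^ 2 = ω4 + 1 := by
  linear_combination ω4_spec - (ω4 + 1) * two_eq_zero_F4

lemma ω4_ne_zero : ω4 ≠ 0 := fun h => by simpa [h] using ω4_spec

lemma ω4_ne_one : ω4 ≠ 1 := fun h => by
  have := ω4_sq
  simp [h] at this

lemma ω4_add_one_ne_zero : ω4 + 1 ≠ 0 := by
  rw [← ω4_sq]
  exact pow_ne_zero 2 ω4_ne_zero

lemma pow_three_F4 {s : F4} (hs : s ≠ 0) : s ^ 3 = 1 := by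
  have h := FiniteField.pow_card_sub_one_eq_one s hs
  rwa [F4.card_eq] at h

lemma eq_of_F4 (x : F4) : x = 0 ∨ x = 1 ∨ x = ω4 ∨ x = ω4 ^ 2 := by
  by_cases hx : x = 0
  · exact Or.inl hx
  have h : (x - 1) * ((x - ω4) * (x - ω4 ^ 2)) = 0 := by
    linear_combination pow_three_F4 hx + (-x * ω4 + 2 * x - x ^ 2 - ω4 + 1) * ω4_spec +
      (x * ω4 ^ 3 - x) * two_eq_zero_F4
  simpa [hx, sub_eq_zero] using h

/-- Representatives of the five points of the projective line over `F₄`, and of the zero vector. -/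
noncomputable def pointRep : Option (Fin 5) → F4 × F4
  | none => 0
  | some j => ![(0, 1), (1, 0), (1, 1), (1, ω4), (1, ω4 ^ 2)] j

open scoped Classical in
/-- The point of the projective line over `F₄` on which a vector lies (`none` for the zero
vector). -/
noncomputable def pointClass (v : F4 × F4) : Option (Fin 5) :=
  if v.1 = 0 then if v.2 = 0 then none else some 0
  else if v.2 = 0 then some 1
  else if v.2 = v.1 then some 2
  else if v.2 = v.1 * ω4 then some 3
  else some 4

lemma exists_smul_pointRep (v : F4 × F4) :
    ∃ s : F4, s ≠ 0 ∧ v = s • pointRep (pointClass v) := by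
  obtain ⟨x, y⟩ := v
  by_cases hx : x = 0
  · subst hx
    by_cases hy : y = 0
    · exact ⟨1, one_ne_zero, by simp [pointClass, pointRep, hy]⟩
    · exact ⟨y, hy, by simp [pointClass, pointRep, hy]⟩
  · refine ⟨x, hx, ?_⟩
    obtain ⟨t, rfl⟩ : ∃ t, y = x * t := ⟨y / x, by field_simp⟩
    rcases eq_of_F4 t with rfl | rfl | rfl | rfl <;>
      simp [pointClass, pointRep, hx, ω4_ne_zero, ω4_ne_one, ω4_sq, ω4_add_one_ne_zero]

lemma pointClass_smul {s : F4} (hs : s ≠ 0) (v : F4 × F4) :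
    pointClass (s • v) = pointClass v := by
  classical
  simp [pointClass, hs, mul_assoc]

lemma pointClass_pointRep (k : Option (Fin 5)) : pointClass (pointRep k) = k := by
  rcases k with _ | k
  · simp [pointClass, pointRep]
  · fin_cases k <;>
      simp [pointClass, pointRep, ω4_ne_zero, ω4_ne_one, ω4_sq, ω4_add_one_ne_zero]

lemma pointClass_eq_none {v : F4 × F4} : pointClass v = none ↔ v = 0 := by
  refine ⟨fun h => ?_, fun h => by simp [h, pointClass]⟩
  obtain ⟨s, -, hv⟩ := exists_smul_pointRep v
  rw [hv, h]
  simp [pointRep]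

/-- The linear form `(x, y) ↦ a x + b y`. -/
noncomputable def form (a b : F4) : Module.Dual F4 (F4 × F4) :=
  a • LinearMap.fst F4 F4 F4 + b • LinearMap.snd F4 F4 F4

@[simp]
lemma form_apply (a b : F4) (v : F4 × F4) : form a b v = a * v.1 + b * v.2 := rfl

lemma eq_form (φ : Module.Dual F4 (F4 × F4)) : φ = form (φ (1, 0)) (φ (0, 1)) := by
  ext <;> simp

/-- A linear form vanishing on the point `k`. -/
noncomputable def pointForm (k : Fin 5) : Module.Dual F4 (F4 × F4) :=
  form (pointRep (some k)).2 (pointRep (some k)).1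

lemma pointForm_pointRep (k j : Fin 5) : pointForm k (pointRep (some j)) = 0 ↔ j = k := by
  have h2 := two_eq_zero_F4
  have h11 : (1 : F4) + 1 = 0 := by linear_combination h2
  have e1 : (1 : F4) + ω4 ≠ 0 := by rw [add_comm]; exact ω4_add_one_ne_zero
  have e2 : ω4 + 1 + 1 = ω4 := by linear_combination h2
  have e3 : 1 + (ω4 + 1) = ω4 := by linear_combination h2
  have e4 : ω4 + 1 + ω4 = 1 := by linear_combination ω4 * h2
  have e5 : ω4 + (ω4 + 1) = 1 := by linear_combination ω4 * h2
  fin_cases k <;> fin_cases j <;>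
    simp [pointForm, pointRep, ω4_ne_zero, ω4_sq, ω4_add_one_ne_zero, h11, e1, e2, e3, e4, e5,
      CharTwo.add_self_eq_zero]

lemma pointForm_eq_zero_iff (k : Fin 5) (v : F4 × F4) :
    pointForm k v = 0 ↔ pointClass v = none ∨ pointClass v = some k := by
  obtain ⟨s, hs, hv⟩ := exists_smul_pointRep v
  generalize pointClass v = j at hv
  subst hv
  rcases j with _ | j
  · simp [pointRep]
  · simp [hs, pointForm_pointRep]

lemma pointForm_ne_zero (k : Fin 5) : pointForm k ≠ 0 := by
  intro h
  obtain ⟨j, hj⟩ := exists_ne k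
  exact hj ((pointForm_pointRep k j).1 (by simp [h]))

lemma exists_smul_pointForm {φ : Module.Dual F4 (F4 × F4)} (hφ : φ ≠ 0) :
    ∃ (k : Fin 5) (s : F4), s ≠ 0 ∧ φ = s • pointForm k := by
  obtain ⟨s, hs, h⟩ := exists_smul_pointRep (φ (0, 1), φ (1, 0))
  rcases hk : pointClass (φ (0, 1), φ (1, 0)) with _ | k
  · rw [pointClass_eq_none, Prod.mk_eq_zero] at hk
    refine absurd ?_ hφ
    rw [eq_form φ, hk.1, hk.2]
    ext <;> simp
  · rw [hk] at h
    refine ⟨k, s, hs, ?_⟩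
    have h1 := congrArg Prod.fst h
    have h2 := congrArg Prod.snd h
    rw [eq_form φ]
    simp only [Prod.smul_fst, Prod.smul_snd] at h1 h2
    rw [h1, h2]
    ext <;> simp [pointForm]

section ColumnCode

variable {n : ℕ}

/-- Evaluation of linear forms at the columns `c i`. -/
noncomputable def evalColumns (c : Fin n → F4 × F4) :
    Module.Dual F4 (F4 × F4) →ₗ[F4] (Fin n → F4) :=
  LinearMap.pi fun i => LinearMap.applyₗ (c i)

@[simp]
lemma evalColumns_apply (c : Fin n → F4 × F4) (φ : Module.Dual F4 (F4 × F4)) (i : Fin n) :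
    evalColumns c φ i = φ (c i) := rfl

/-- The code generated by the rows of the matrix with columns `c i`. -/
noncomputable def columnCode (c : Fin n → F4 × F4) : Submodule F4 (Fin n → F4) :=
  LinearMap.range (evalColumns c)

/-- The number of columns in the class `k`. -/
noncomputable def mult (c : Fin n → F4 × F4) (k : Option (Fin 5)) : ℕ :=
  (univ.filter fun i => pointClass (c i) = k).card

lemma sum_mult (c : Fin n → F4 × F4) : mult c none + ∑ j, mult c (some j) = n := by
  rw [← Fintype.sum_option (mult c)]
  have h := Finset.card_eq_sum_card_fiberwise (s := (univ : Finset (Fin n))) (t := univ)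
    (f := fun i => pointClass (c i)) (fun _ _ => by simp)
  simpa [mult] using h.symm

lemma exists_mult_eq (p : Option (Fin 5) → ℕ) (hp : ∑ k, p k = n) :
    ∃ c : Fin n → F4 × F4, mult c = p := by
  obtain ⟨e⟩ : Nonempty (Fin n ≃ Σ k, Fin (p k)) :=
    ⟨Fintype.equivOfCardEq (by simp [← hp])⟩
  refine ⟨fun i => pointRep (e i).1, funext fun k => ?_⟩
  simp only [mult, pointClass_pointRep]
  rw [← Fintype.card_subtype,
    Fintype.card_congr (e.subtypeEquiv (q := fun x => x.1 = k) fun _ => Iff.rfl),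
    Fintype.card_congr (Equiv.sigmaSubtype k)]
  simp

lemma wt_smul_pointForm (c : Fin n → F4 × F4) {s : F4} (hs : s ≠ 0) (k : Fin 5) :
    wt (evalColumns c (s • pointForm k)) + (mult c none + mult c (some k)) = n := by
  classical
  have hd : mult c none + mult c (some k) =
      (univ.filter fun i => ¬ evalColumns c (s • pointForm k) i ≠ 0).card := by
    rw [mult, mult, ← Finset.card_union_of_disjoint, ← Finset.filter_or]
    · congr 1
      ext i
      simp [hs, pointForm_eq_zero_iff, or_iff_not_imp_left]
    · refine Finset.disjoint_filter.2 fun i _ h => ?_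
      simp [h]
  rw [hd, wt]
  convert Finset.card_filter_add_card_filter_not (s := (univ : Finset (Fin n))) _
  simp

lemma codeEquiv_of_mult_eq {c c' : Fin n → F4 × F4} (h : mult c = mult c') :
    codeEquiv (columnCode c) (columnCode c') := by
  let e (k : Option (Fin 5)) :
      {i // pointClass (c' i) = k} ≃ {i // pointClass (c i) = k} :=
    Fintype.equivOfCardEq (by
      rw [Fintype.card_subtype, Fintype.card_subtype]
      exact (congrFun h k).symm)
  have hσ := Equiv.ofFiberEquiv_map e
  set σ := Equiv.ofFiberEquiv e
  have hs (i : Fin n) : ∃ s : F4, s ≠ 0 ∧ c' i = s • c (σ i) := by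
    obtain ⟨s, hs, h1⟩ := exists_smul_pointRep (c' i)
    obtain ⟨t, ht, h2⟩ := exists_smul_pointRep (c (σ i))
    refine ⟨s * t⁻¹, by simp [hs, ht], ?_⟩
    rw [hσ] at h2
    rw [h2, smul_smul, inv_mul_cancel_right₀ ht, ← h1]
  choose s hs hc using hs
  refine ⟨σ, s, hs, ?_⟩
  rw [columnCode, columnCode, ← LinearMap.range_comp]
  congr 1
  ext φ i
  simp [monoMap, hc]

lemma columnCode_comp (c : Fin n → F4 × F4) (A : (F4 × F4) ≃ₗ[F4] (F4 × F4)) :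
    columnCode (fun i => A (c i)) = columnCode c := by
  have h : evalColumns (fun i => A (c i)) = evalColumns c ∘ₗ A.dualMap := by
    ext φ i
    simp
  rw [columnCode, columnCode, h, LinearMap.range_comp_of_range_eq_top _ A.dualMap.range]

lemma exists_columnCode_eq (D : Submodule F4 (Fin n → F4)) (hD : Module.finrank F4 D = 2) :
    ∃ c : Fin n → F4 × F4, columnCode c = D := by
  let b := Module.finBasisOfFinrankEq F4 D hD
  refine ⟨fun i => ((b 0 : Fin n → F4) i, (b 1 : Fin n → F4) i), ?_⟩
  ext x
  constructor
  · rintro ⟨φ, rfl⟩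
    rw [eq_form φ]
    have : evalColumns (fun i => ((b 0 : Fin n → F4) i, (b 1 : Fin n → F4) i))
        (form (φ (1, 0)) (φ (0, 1))) = ((φ (1, 0) • b 0 + φ (0, 1) • b 1 : D) : Fin n → F4) := by
      ext i
      simp
    rw [this]
    exact Subtype.property _
  · intro hx
    have h := congrArg (Subtype.val) (b.sum_repr ⟨x, hx⟩)
    refine ⟨form (b.repr ⟨x, hx⟩ 0) (b.repr ⟨x, hx⟩ 1), ?_⟩
    ext i
    have hi := congrFun h i
    simp only [Fin.sum_univ_two] at hi
    simpa using hi

lemma injective_of_finrank {c : Fin n → F4 × F4} (h : Module.finrank F4 (columnCode c) = 2) :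
    Function.Injective (evalColumns c) := by
  have h2 := (evalColumns c).finrank_range_add_finrank_ker
  rw [columnCode] at h
  rw [h, Subspace.dual_finrank_eq] at h2
  simp at h2
  exact LinearMap.ker_eq_bot.1 h2

lemma finrank_columnCode {c : Fin n → F4 × F4} (h : Function.Injective (evalColumns c)) :
    Module.finrank F4 (columnCode c) = 2 := by
  rw [columnCode, LinearMap.finrank_range_of_inj h, Subspace.dual_finrank_eq]
  simp

/-- The Hermitian inner product of two codewords depends only on the column multiplicities. -/
lemma hermInner_evalColumns (c : Fin n → F4 × F4) (φ ψ : Module.Dual F4 (F4 × F4)) :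
    hermInner (evalColumns c φ) (evalColumns c ψ) =
      ∑ j, (mult c (some j) : F4) * (φ (pointRep (some j)) * ψ (pointRep (some j)) ^ 2) := by
  have h (i : Fin n) : φ (c i) * ψ (c i) ^ 2 =
      φ (pointRep (pointClass (c i))) * ψ (pointRep (pointClass (c i))) ^ 2 := by
    obtain ⟨s, hs, h⟩ := exists_smul_pointRep (c i)
    have h1 : φ (c i) = s * φ (pointRep (pointClass (c i))) := by
      conv_lhs => rw [h]
      simp
    have h2 : ψ (c i) = s * ψ (pointRep (pointClass (c i))) := by
      conv_lhs => rw [h]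
      simp
    rw [h1, h2]
    linear_combination φ (pointRep (pointClass (c i))) * ψ (pointRep (pointClass (c i))) ^ 2 *
      pow_three_F4 hs
  simp only [hermInner, evalColumns_apply, h]
  rw [← Finset.sum_fiberwise_of_maps_to (s := univ) (t := univ) (g := fun i => pointClass (c i))
    (fun _ _ => mem_univ _), Fintype.sum_option]
  have hk (k : Option (Fin 5)) : (∑ i with pointClass (c i) = k,
      φ (pointRep (pointClass (c i))) * ψ (pointRep (pointClass (c i))) ^ 2) =
      (mult c k : F4) * (φ (pointRep k) * ψ (pointRep k) ^ 2) := by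
    rw [mult, ← nsmul_eq_mul, ← Finset.sum_const]
    refine Finset.sum_congr rfl fun i hi => ?_
    rw [(Finset.mem_filter.1 hi).2]
  simp only [hk]
  simp [pointRep]

lemma isHermLCD_iff_forall {c : Fin n → F4 × F4} (h : Function.Injective (evalColumns c)) :
    IsHermLCD (columnCode c) ↔
      ∀ φ, (∀ ψ, hermInner (evalColumns c φ) (evalColumns c ψ) = 0) → φ = 0 := by
  rw [IsHermLCD, Submodule.eq_bot_iff]
  constructor
  · intro H φ hφ
    refine h ?_
    rw [map_zero]
    refine H _ ⟨⟨φ, rfl⟩, ?_⟩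
    rintro _ ⟨ψ, rfl⟩
    exact hφ ψ
  · rintro H _ ⟨⟨φ, rfl⟩, hφ⟩
    rw [H φ fun ψ => hφ _ ⟨ψ, rfl⟩, map_zero]

lemma odd_pairs_iff (a b c d e : ℕ) :
    Odd (a * (b + c + d + e) + b * (c + d + e) + c * (d + e) + d * e) ↔
      a % 2 + b % 2 + c % 2 + d % 2 + e % 2 = 2 ∨ a % 2 + b % 2 + c % 2 + d % 2 + e % 2 = 3 := by
  rw [Nat.odd_iff]
  rcases Nat.mod_two_eq_zero_or_one a with ha | ha <;>
  rcases Nat.mod_two_eq_zero_or_one b with hb | hb <;>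
  rcases Nat.mod_two_eq_zero_or_one c with hc | hc <;>
  rcases Nat.mod_two_eq_zero_or_one d with hd | hd <;>
  rcases Nat.mod_two_eq_zero_or_one e with he | he <;>
  simp [Nat.add_mod, Nat.mul_mod, ha, hb, hc, hd, he]

lemma isHermLCD_iff {c : Fin n → F4 × F4} (h : Function.Injective (evalColumns c)) :
    IsHermLCD (columnCode c) ↔
      ∑ j, mult c (some j) % 2 = 2 ∨ ∑ j, mult c (some j) % 2 = 3 := by
  rw [isHermLCD_iff_forall h]
  simp only [hermInner_evalColumns, Fin.sum_univ_five]
  generalize mult c (some 0) = p₀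
  generalize mult c (some 1) = p₁
  generalize mult c (some 2) = p₂
  generalize mult c (some 3) = p₃
  generalize mult c (some 4) = p₄
  rw [← odd_pairs_iff, ← Nat.not_even_iff_odd, even_iff_two_dvd, ← CharP.cast_eq_zero_iff F4 2]
  push_cast
  have h2 := two_eq_zero_F4
  obtain ⟨G₁, hG₁⟩ : ∃ x : F4, x = p₁ + p₂ + p₃ + p₄ := ⟨_, rfl⟩
  obtain ⟨G₂, hG₂⟩ : ∃ x : F4, x = p₀ + p₂ + p₃ + p₄ := ⟨_, rfl⟩
  obtain ⟨H₁, hH₁⟩ : ∃ x : F4, x = p₂ + ω4 * p₃ + ω4 ^ 2 * p₄ := ⟨_, rfl⟩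
  obtain ⟨H₂, hH₂⟩ : ∃ x : F4, x = p₂ + ω4 ^ 2 * p₃ + ω4 * p₄ := ⟨_, rfl⟩
  have hdet : (p₀ * (p₁ + p₂ + p₃ + p₄) + p₁ * (p₂ + p₃ + p₄) + p₂ * (p₃ + p₄) + p₃ * p₄ : F4) =
      G₁ * G₂ - H₁ * H₂ := by
    rw [hG₁, hG₂, hH₁, hH₂]
    linear_combination (p₂ * p₃ + p₂ * p₄ + (ω4 - 1) * (p₃ ^ 2 + p₄ ^ 2) +
      p₃ * p₄ * (1 + ω4 ^ 2 - ω4) : F4) * ω4_spec - (p₂ * p₃ + p₂ * p₄ + p₃ * p₄ : F4) * h2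
  have hgram (a b : F4) (ψ : Module.Dual F4 (F4 × F4)) :
      (p₀ : F4) * (form a b (pointRep (some 0)) * ψ (pointRep (some 0)) ^ 2) +
      p₁ * (form a b (pointRep (some 1)) * ψ (pointRep (some 1)) ^ 2) +
      p₂ * (form a b (pointRep (some 2)) * ψ (pointRep (some 2)) ^ 2) +
      p₃ * (form a b (pointRep (some 3)) * ψ (pointRep (some 3)) ^ 2) +
      p₄ * (form a b (pointRep (some 4)) * ψ (pointRep (some 4)) ^ 2) =
      (a * G₁ + b * H₁) * ψ (1, 0) ^ 2 + (a * H₂ + b * G₂) * ψ (0, 1) ^ 2 := by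
    rw [eq_form ψ]
    generalize ψ (1, 0) = x
    generalize ψ (0, 1) = y
    simp [pointRep, hG₁, hG₂, hH₁, hH₂]
    linear_combination (p₂ * (a + b) * x * y + p₃ * (a + ω4 * b) * ω4 * x * y +
      p₄ * (a + ω4 ^ 2 * b) * ω4 ^ 2 * x * y) * h2 + (p₃ * b * (ω4 - 1) * y ^ 2 +
      p₄ * (a * ω4 + b * (ω4 ^ 3 + 1)) * (ω4 - 1) * y ^ 2) * ω4_spec
  rw [hdet]
  constructor
  · intro H hz
    have key (a b : F4) (h1 : a * G₁ + b * H₁ = 0) (h2 : a * H₂ + b * G₂ = 0) :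
        a = 0 ∧ b = 0 := by
      have h0 := H (form a b) fun ψ => by rw [hgram, h1, h2]; ring
      have ha := LinearMap.congr_fun h0 (1, 0)
      have hb := LinearMap.congr_fun h0 (0, 1)
      simpa using And.intro ha hb
    obtain ⟨hG2, hH2⟩ := key G₂ (-H₂) (by linear_combination hz) (by ring)
    obtain ⟨hH1, hG1⟩ := key H₁ (-G₁) (by ring) (by linear_combination -hz)
    have := key 1 0 (by simpa using hG1) (by simpa using hH2)
    exact one_ne_zero this.1
  · intro hz φ hφ
    rw [eq_form φ] at hφ ⊢
    generalize φ (1, 0) = a at hφ ⊢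
    generalize φ (0, 1) = b at hφ ⊢
    simp only [hgram] at hφ
    have e1 := hφ (form 1 0)
    have e2 := hφ (form 0 1)
    simp at e1 e2
    have ha : a = 0 := by
      refine (mul_eq_zero.1 ?_).resolve_right hz
      linear_combination G₂ * e1 - H₁ * e2
    have hb : b = 0 := by
      refine (mul_eq_zero.1 ?_).resolve_right hz
      linear_combination G₁ * e2 - H₂ * e1
    ext <;> simp [ha, hb]

lemma injective_of_mult_lt {c : Fin n → F4 × F4}
    (h : ∀ k, mult c none + mult c (some k) < n) : Function.Injective (evalColumns c) := by
  classical
  rw [← LinearMap.ker_eq_bot, Submodule.eq_bot_iff]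
  intro φ hφ
  by_contra h0
  obtain ⟨k, s, hs, rfl⟩ := exists_smul_pointForm h0
  have hw := wt_smul_pointForm c hs k
  rw [LinearMap.mem_ker.1 hφ] at hw
  have := h k
  simp [wt] at hw
  omega

lemma exists_wt_eq_iff {c : Fin n → F4 × F4} (h : Function.Injective (evalColumns c)) (w : ℕ) :
    (∃ x ∈ columnCode c, x ≠ 0 ∧ wt x = w) ↔
      ∃ k, w + (mult c none + mult c (some k)) = n := by
  constructor
  · rintro ⟨_, ⟨φ, rfl⟩, h0, rfl⟩
    obtain ⟨k, s, hs, rfl⟩ := exists_smul_pointForm (φ := φ) (by rintro rfl; simp at h0)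
    exact ⟨k, wt_smul_pointForm c hs k⟩
  · rintro ⟨k, hk⟩
    have hw := wt_smul_pointForm c one_ne_zero k
    rw [one_smul] at hw
    refine ⟨_, ⟨pointForm k, rfl⟩, ?_, by omega⟩
    rw [← map_zero (evalColumns c)]
    exact h.ne (pointForm_ne_zero k)

lemma hasMinWeight_columnCode_iff {c : Fin n → F4 × F4}
    (h : Function.Injective (evalColumns c)) (d : ℕ) :
    hasMinWeight (columnCode c) d ↔
      (∀ k, d + (mult c none + mult c (some k)) ≤ n) ∧
        ∃ k, d + (mult c none + mult c (some k)) = n := by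
  rw [hasMinWeight, exists_wt_eq_iff h]
  refine and_congr_left fun _ => ⟨fun H k => ?_, fun H x hx h0 => ?_⟩
  · have hw := wt_smul_pointForm c one_ne_zero k
    rw [one_smul] at hw
    have := H _ ⟨pointForm k, rfl⟩ (by
      rw [← map_zero (evalColumns c)]
      exact h.ne (pointForm_ne_zero k))
    omega
  · obtain ⟨k, hk⟩ := (exists_wt_eq_iff h (wt x)).1 ⟨x, hx, h0, rfl⟩
    have := H k
    omega

lemma isOptimalLCD_columnCode_iff {m : ℕ} {c : Fin (5 * m + 4) → F4 × F4}
    (h : Function.Injective (evalColumns c)) :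
    IsOptimalLCD (5 * m + 4) (4 * m + 2) (columnCode c) ↔
      (∀ k, mult c none + mult c (some k) ≤ m + 2) ∧
      (∃ k, mult c none + mult c (some k) = m + 2) ∧
      (∑ j, mult c (some j) % 2 = 2 ∨ ∑ j, mult c (some j) % 2 = 3) := by
  have hopt : 4 * m + 2 = optimalDist (5 * m + 4) := by
    rw [optimalDist, if_neg] <;> omega
  have h1 (k : Fin 5) : 4 * m + 2 + (mult c none + mult c (some k)) ≤ 5 * m + 4 ↔
      mult c none + mult c (some k) ≤ m + 2 := by omega
  have h2 (k : Fin 5) : 4 * m + 2 + (mult c none + mult c (some k)) = 5 * m + 4 ↔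
      mult c none + mult c (some k) = m + 2 := by omega
  rw [IsOptimalLCD, hasMinWeight_columnCode_iff h, isHermLCD_iff h]
  simp only [finrank_columnCode h, h1, h2, ← hopt, true_and, and_true, and_assoc]

lemma hasMinWeight_hermDual_one_iff (c : Fin n → F4 × F4) :
    hasMinWeight (hermDual (columnCode c)) 1 ↔ mult c none ≠ 0 := by
  classical
  have hpos (x : Fin n → F4) (h0 : x ≠ 0) : 1 ≤ wt x := by
    obtain ⟨i, hi⟩ := Function.ne_iff.1 h0
    exact Finset.card_pos.2 ⟨i, by simpa using hi⟩
  have hmult : mult c none ≠ 0 ↔ ∃ i, c i = 0 := by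
    rw [mult, Finset.card_ne_zero]
    simp [Finset.Nonempty, pointClass_eq_none]
  rw [hmult]
  constructor
  · rintro ⟨-, x, hx, -, hw⟩
    obtain ⟨i, hi⟩ := Finset.card_eq_one.1 hw
    have hxj (j : Fin n) : x j ≠ 0 ↔ j = i := by
      simpa using Finset.ext_iff.1 hi j
    have key (φ : Module.Dual F4 (F4 × F4)) : φ (c i) = 0 := by
      have h := hx _ ⟨φ, rfl⟩
      rw [hermInner, Finset.sum_eq_single i (fun j _ hj => by
        rw [not_not.1 (mt (hxj j).1 hj), zero_mul]) (by simp)] at h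
      simpa [(hxj i).2 rfl] using h
    refine ⟨i, Prod.ext ?_ ?_⟩
    · simpa using key (form 1 0)
    · simpa using key (form 0 1)
  · rintro ⟨i, hi⟩
    refine ⟨fun x _ => hpos x, Pi.single i 1, ?_, by simp, ?_⟩
    · rintro _ ⟨φ, rfl⟩
      simp [hermInner, Pi.single_apply, hi]
    · simp [wt, Pi.single_apply, Finset.filter_eq']

lemma codeEquiv.exists_wt_eq {C C' : Submodule F4 (Fin n → F4)} (h : codeEquiv C C') (w : ℕ) :
    (∃ x ∈ C, x ≠ 0 ∧ wt x = w) ↔ ∃ x ∈ C', x ≠ 0 ∧ wt x = w := by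
  classical
  obtain ⟨σ, s, hs, rfl⟩ := h
  have hwt (x : Fin n → F4) : wt (monoMap σ s x) = wt x := by
    rw [wt, wt]
    refine Finset.card_equiv σ fun i => ?_
    simp [monoMap, hs]
  have h0 (x : Fin n → F4) : monoMap σ s x ≠ 0 ↔ x ≠ 0 := by
    simp only [Function.ne_iff]
    simpa [monoMap, hs] using (σ.surjective.exists (p := fun i => x i ≠ 0)).symm
  simp only [Submodule.mem_map, exists_exists_and_eq_and, hwt, h0]

/-- The permutations of the points of the projective line induced by linear automorphisms. -/
def projectivePerms : Subgroup (Equiv.Perm (Fin 5)) where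
  carrier := {π | ∃ A : (F4 × F4) ≃ₗ[F4] (F4 × F4),
    ∀ v, pointClass (A v) = (pointClass v).map π}
  one_mem' := ⟨LinearEquiv.refl _ _, fun v => by simp⟩
  mul_mem' := by
    rintro π ρ ⟨A, hA⟩ ⟨B, hB⟩
    exact ⟨B.trans A, fun v => by simp [hA, hB]⟩
  inv_mem' := by
    rintro π ⟨A, hA⟩
    refine ⟨A.symm, fun v => ?_⟩
    have h := hA (A.symm v)
    rw [A.apply_symm_apply] at h
    simp [h, Function.comp_def]

lemma mem_projectivePerms {π : Equiv.Perm (Fin 5)} (A : (F4 × F4) ≃ₗ[F4] (F4 × F4))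
    (f : Fin 5 → Fin 5) (hf : ∀ j, π j = f j) (s : Fin 5 → F4) (hs : ∀ j, s j ≠ 0)
    (h : ∀ j, A (pointRep (some j)) = s j • pointRep (some (f j))) : π ∈ projectivePerms := by
  refine ⟨A, fun v => ?_⟩
  obtain ⟨t, ht, hv⟩ := exists_smul_pointRep v
  generalize pointClass v = j at hv
  subst hv
  rw [map_smul, pointClass_smul ht]
  rcases j with _ | j
  · simp [pointRep, pointClass]
  · rw [h, pointClass_smul (hs j), pointClass_pointRep, Option.map_some, hf]

lemma alternatingGroup_le_projectivePerms : alternatingGroup (Fin 5) ≤ projectivePerms := by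
  have h2 := two_eq_zero_F4
  have e1 : 1 + (ω4 + 1) = ω4 := by linear_combination h2
  have e2 : (ω4 + 1) * ω4 = 1 := by linear_combination ω4_sq + ω4 * h2
  have e3 : ω4 * (ω4 + 1) = 1 := by linear_combination ω4_sq + ω4 * h2
  have e4 : ω4 * ω4 = ω4 + 1 := by linear_combination ω4_sq
  have e5 : 1 + ω4 = ω4 + 1 := add_comm _ _
  have hswap : (Equiv.swap 0 1 * Equiv.swap 3 4 : Equiv.Perm (Fin 5)) ∈ projectivePerms := by
    refine mem_projectivePerms (LinearEquiv.prodComm F4 F4 F4) ![1, 0, 2, 4, 3] (by decide)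
      ![1, 1, 1, ω4, ω4 ^ 2] (fun j => ?_) fun j => ?_
    · fin_cases j <;> simp [ω4_ne_zero]
    · fin_cases j <;> simp [pointRep, ω4_sq, e2, e3]
  have hshear : (Equiv.swap 1 2 * Equiv.swap 3 4 : Equiv.Perm (Fin 5)) ∈ projectivePerms := by
    obtain ⟨A, hA⟩ : ∃ A : (F4 × F4) ≃ₗ[F4] (F4 × F4), ∀ v, A v = (v.1, v.1 + v.2) := by
      refine ⟨LinearEquiv.ofInvolutive
        ((LinearMap.fst F4 F4 F4).prod (LinearMap.fst F4 F4 F4 + LinearMap.snd F4 F4 F4))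
        fun v => ?_, fun v => rfl⟩
      ext <;> simp [← add_assoc, CharTwo.add_self_eq_zero]
    refine mem_projectivePerms A ![0, 2, 1, 4, 3] (by decide) (fun _ => 1)
      (fun _ => one_ne_zero) fun j => ?_
    fin_cases j <;> simp [hA, pointRep, ω4_sq, CharTwo.add_self_eq_zero, e1, e5]
  have hdiag : (Equiv.swap 3 2 * Equiv.swap 3 4 : Equiv.Perm (Fin 5)) ∈ projectivePerms := by
    refine mem_projectivePerms ((LinearEquiv.refl F4 F4).prodCongr
      (LinearEquiv.smulOfNeZero F4 F4 ω4 ω4_ne_zero)) ![0, 1, 3, 4, 2] (by decide)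
      ![ω4, 1, 1, 1, 1] (fun j => ?_) fun j => ?_
    · fin_cases j <;> simp [ω4_ne_zero]
    · fin_cases j <;> simp [pointRep, ω4_sq, e3, e4]
  have htrans : MulAction.IsPretransitive projectivePerms (Fin 5) := by
    rw [MulAction.isPretransitive_iff_base (0 : Fin 5)]
    have h (π : Equiv.Perm (Fin 5)) (hπ : π ∈ projectivePerms) :
        ∃ g : projectivePerms, g • (0 : Fin 5) = π 0 := ⟨⟨π, hπ⟩, rfl⟩
    intro j
    fin_cases j
    · exact h 1 (one_mem _)
    · exact h _ hswap
    · exact h _ (mul_mem hshear hswap)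
    · exact h _ (mul_mem hdiag (mul_mem hshear hswap))
    · exact h _ (mul_mem hdiag (mul_mem hdiag (mul_mem hshear hswap)))
  exact Equiv.Perm.alternatingGroup_le_of_isPreprimitive_of_isThreeCycle_mem
    (MulAction.IsPreprimitive.of_prime_card (by norm_num))
    (Equiv.Perm.isThreeCycle_swap_mul_swap_same (by decide : (3 : Fin 5) ≠ 2) (by decide)
      (by decide)) hdiag

lemma exists_mult_perm (c : Fin n → F4 × F4) {π : Equiv.Perm (Fin 5)}
    (hπ : π ∈ projectivePerms) :
    ∃ c' : Fin n → F4 × F4, columnCode c' = columnCode c ∧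
      ∀ k, mult c' k = mult c (k.map π) := by
  obtain ⟨A, hA⟩ := projectivePerms.inv_mem hπ
  refine ⟨fun i => A (c i), columnCode_comp c A, fun k => ?_⟩
  simp only [mult, hA]
  congr 1
  ext i
  simp only [mem_filter, mem_univ, true_and]
  rcases pointClass (c i) with _ | j <;> rcases k with _ | k <;> simp [Equiv.symm_apply_eq]

lemma exists_monotone_mult (c : Fin n → F4 × F4) {j k : Fin 5} (hjk : j ≠ k)
    (hm : mult c (some j) = mult c (some k)) :
    ∃ c' : Fin n → F4 × F4, columnCode c' = columnCode c ∧ mult c' none = mult c none ∧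
      Monotone fun i => mult c' (some i) := by
  set f : Fin 5 → ℕ := fun i => mult c (some i)
  obtain ⟨π, hπ, hmono⟩ : ∃ π ∈ alternatingGroup (Fin 5), Monotone (f ∘ π) := by
    by_cases h : Tuple.sort f ∈ alternatingGroup (Fin 5)
    · exact ⟨_, h, Tuple.monotone_sort f⟩
    · refine ⟨Equiv.swap j k * Tuple.sort f, ?_, ?_⟩
      · rw [Equiv.Perm.mem_alternatingGroup] at h ⊢
        rw [map_mul, Equiv.Perm.sign_swap hjk, (Int.units_eq_one_or _).resolve_left h]
        rfl
      · have hf : f ∘ Equiv.swap j k = f := by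
          ext i
          simp only [Function.comp_apply, Equiv.swap_apply_def]
          split_ifs with h1 h2
          · rw [h1]; exact hm.symm
          · rw [h2]; exact hm
          · rfl
        rw [Equiv.Perm.coe_mul, ← Function.comp_assoc, hf]
        exact Tuple.monotone_sort f
  obtain ⟨c', hc', h⟩ := exists_mult_perm c (alternatingGroup_le_projectivePerms hπ)
  exact ⟨c', hc', h none, by
    simp only [h, Option.map_some]
    exact hmono⟩

end ColumnCode

/-- The amounts by which the multiplicities of the five points fall short of their maximal value
in the six optimal codes. -/
def deficit : Fin 6 → Fin 5 → ℕ :=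
  ![![5, 1, 0, 0, 0], ![3, 3, 0, 0, 0], ![4, 1, 1, 0, 0], ![3, 2, 1, 0, 0], ![2, 2, 1, 1, 0],
    ![1, 1, 0, 0, 0]]

/-- The multiplicities of the column classes in the six optimal codes of length `5 m + 4`. -/
def optimalMult (m : ℕ) (i : Fin 6) : Option (Fin 5) → ℕ
  | none => if i = 5 then 1 else 0
  | some j => m + 2 - (if i = 5 then 1 else 0) - deficit i j

lemma deficit_add_optimalMult {m : ℕ} (hm : 3 ≤ m) (i : Fin 6) (j : Fin 5) :
    deficit i j + (optimalMult m i none + optimalMult m i (some j)) = m + 2 := by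
  have h : ∀ i j, deficit i j ≤ 5 ∧ deficit 5 j ≤ 1 := by decide
  have := h i j
  simp only [optimalMult]
  split_ifs with h5
  · subst h5
    omega
  · omega

lemma sum_optimalMult {m : ℕ} (hm : 3 ≤ m) (i : Fin 6) :
    ∑ k, optimalMult m i k = 5 * m + 4 := by
  rw [Fintype.sum_option, Fin.sum_univ_five]
  fin_cases i <;> simp [optimalMult, deficit] <;> omega

lemma sum_optimalMult_mod_two {m : ℕ} (hm : 3 ≤ m) (i : Fin 6) :
    ∑ j, optimalMult m i (some j) % 2 = 2 ∨ ∑ j, optimalMult m i (some j) % 2 = 3 := by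
  simp only [Fin.sum_univ_five]
  fin_cases i <;> simp [optimalMult, deficit] <;> omega

lemma exists_eq_optimalMult {m : ℕ} (p : Option (Fin 5) → ℕ)
    (hsum : p none + ∑ j, p (some j) = 5 * m + 4) (hmono : Monotone fun j => p (some j))
    (hle : ∀ k, p none + p (some k) ≤ m + 2) (heq : ∃ k, p none + p (some k) = m + 2)
    (hpar : ∑ j, p (some j) % 2 = 2 ∨ ∑ j, p (some j) % 2 = 3) :
    ∃ i, p = optimalMult m i := by
  have h01 : p (some 0) ≤ p (some 1) := hmono (by decide)
  have h12 : p (some 1) ≤ p (some 2) := hmono (by decide)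
  have h23 : p (some 2) ≤ p (some 3) := hmono (by decide)
  have h34 : p (some 3) ≤ p (some 4) := hmono (by decide)
  have h4 : p none + p (some 4) = m + 2 := by
    obtain ⟨k, hk⟩ := heq
    have h1 : p (some k) ≤ p (some 4) := hmono (Fin.le_last k)
    have h2 := hle 4
    omega
  have hp (i : Fin 6) (h : p none = optimalMult m i none ∧
      p (some 0) = optimalMult m i (some 0) ∧ p (some 1) = optimalMult m i (some 1) ∧
      p (some 2) = optimalMult m i (some 2) ∧ p (some 3) = optimalMult m i (some 3) ∧
      p (some 4) = optimalMult m i (some 4)) : ∃ i, p = optimalMult m i := by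
    obtain ⟨h, h0, h1, h2, h3, h4⟩ := h
    refine ⟨i, funext fun k => ?_⟩
    rcases k with _ | k
    · exact h
    · fin_cases k
      exacts [h0, h1, h2, h3, h4]
  simp only [Fin.sum_univ_five] at hsum hpar
  have hz : p none = 0 ∨ p none = 1 := by omega
  have d3 : p (some 3) = p (some 4) ∨ p (some 3) + 1 = p (some 4) := by omega
  have d2 : p (some 2) = p (some 4) ∨ p (some 2) + 1 = p (some 4) ∨
    p (some 2) + 2 = p (some 4) := by omega
  have d1 : p (some 1) = p (some 4) ∨ p (some 1) + 1 = p (some 4) ∨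
    p (some 1) + 2 = p (some 4) ∨ p (some 1) + 3 = p (some 4) := by omega
  clear hle heq hmono
  rcases hz with hz | hz <;> rcases d3 with d3 | d3 <;> rcases d2 with d2 | d2 | d2 <;>
    rcases d1 with d1 | d1 | d1 | d1 <;>
    first
    | (exfalso; omega)
    | exact hp 0 (by simp [optimalMult, deficit]; omega)
    | exact hp 1 (by simp [optimalMult, deficit]; omega)
    | exact hp 2 (by simp [optimalMult, deficit]; omega)
    | exact hp 3 (by simp [optimalMult, deficit]; omega)
    | exact hp 4 (by simp [optimalMult, deficit]; omega)
    | exact hp 5 (by simp [optimalMult, deficit]; omega)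

lemma not_injective_of_sum_eq {m z : ℕ} {f : Fin 5 → ℕ} (hsum : z + ∑ j, f j = 5 * m + 4)
    (hle : ∀ k, z + f k ≤ m + 2) : ¬ Function.Injective f := by
  intro hf
  have hmono : StrictMono (f ∘ Tuple.sort f) :=
    (Tuple.monotone_sort f).strictMono_of_injective (hf.comp (Tuple.sort f).injective)
  have h01 := hmono (show (0 : Fin 5) < 1 by decide)
  have h12 := hmono (show (1 : Fin 5) < 2 by decide)
  have h23 := hmono (show (2 : Fin 5) < 3 by decide)
  have h34 := hmono (show (3 : Fin 5) < 4 by decide)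
  have h4 := hle (Tuple.sort f 4)
  rw [← Equiv.sum_comp (Tuple.sort f) f, Fin.sum_univ_five] at hsum
  simp only [Function.comp_apply] at h01 h12 h23 h34
  omega

lemma deficit_separates {i j : Fin 6} (h : ∀ w : ℕ, (∃ k, deficit i k = w) ↔ ∃ k, deficit j k = w) :
    i = j := by
  have key : ∀ i j : Fin 6, (∀ k, ∃ l, deficit j l = deficit i k) →
      (∀ k, ∃ l, deficit i l = deficit j k) → i = j := by decide
  exact key i j (fun k => (h _).1 ⟨k, rfl⟩) fun k => (h _).2 ⟨k, rfl⟩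

/-- for `m ≥ 3` there are exactly six equivalence classes of optimal
Hermitian LCD `[5m + 4, 2, 4m + 2]` codes, exactly one of which consists of codes whose
Hermitian dual has minimum weight `1`. -/
theorem stmt13 (m : ℕ) (hm : 3 ≤ m) :
    ∃ C : Fin 6 → Submodule F4 (Fin (5 * m + 4) → F4),
      (∀ i, IsOptimalLCD (5 * m + 4) (4 * m + 2) (C i)) ∧
      (∀ i j, i ≠ j → ¬ codeEquiv (C i) (C j)) ∧
      (∀ D : Submodule F4 (Fin (5 * m + 4) → F4),
        IsOptimalLCD (5 * m + 4) (4 * m + 2) D → ∃ i, codeEquiv D (C i)) ∧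
      (∃! i, hasMinWeight (hermDual (C i)) 1) := by
  choose c hc using fun i => exists_mult_eq (optimalMult m i) (sum_optimalMult hm i)
  have hd (i : Fin 6) (k : Fin 5) :
      deficit i k + (mult (c i) none + mult (c i) (some k)) = m + 2 := by
    rw [hc]
    exact deficit_add_optimalMult hm i k
  have hinj (i : Fin 6) : Function.Injective (evalColumns (c i)) :=
    injective_of_mult_lt fun k => by
      have := hd i k
      omega
  refine ⟨fun i => columnCode (c i), fun i => ?_, fun i j hij h => ?_, fun D hD => ?_, ?_⟩
  · rw [isOptimalLCD_columnCode_iff (hinj i)]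
    refine ⟨fun k => by have := hd i k; omega, ⟨4, ?_⟩, ?_⟩
    · have h0 : ∀ i, deficit i 4 = 0 := by decide
      have := hd i 4
      rw [h0] at this
      omega
    · rw [hc]
      exact sum_optimalMult_mod_two hm i
  · refine hij (deficit_separates fun w => ?_)
    have hw (i : Fin 6) : (∃ k, deficit i k = w) ↔
        ∃ x ∈ columnCode (c i), x ≠ 0 ∧ wt x = 4 * m + 2 + w := by
      rw [exists_wt_eq_iff (hinj i)]
      refine exists_congr fun k => ?_
      have := hd i k
      omega
    rw [hw, hw]
    exact h.exists_wt_eq _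
  · obtain ⟨d, rfl⟩ := exists_columnCode_eq D hD.1
    obtain ⟨hle, -⟩ := (isOptimalLCD_columnCode_iff (injective_of_finrank hD.1)).1 hD
    obtain ⟨j, k, hjk, hm⟩ : ∃ j k, j ≠ k ∧ mult d (some j) = mult d (some k) := by
      have := not_injective_of_sum_eq (sum_mult d) hle
      simp only [Function.Injective, not_forall] at this
      obtain ⟨j, k, hm, hjk⟩ := this
      exact ⟨j, k, hjk, hm⟩
    obtain ⟨d', hd', -, hmono⟩ := exists_monotone_mult d hjk hm
    rw [← hd'] at hD ⊢
    obtain ⟨hle, heq, hpar⟩ := (isOptimalLCD_columnCode_iff (injective_of_finrank hD.1)).1 hD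
    obtain ⟨i, hi⟩ := exists_eq_optimalMult (mult d') (sum_mult d') hmono hle heq hpar
    exact ⟨i, codeEquiv_of_mult_eq (hi.trans (hc i).symm)⟩
  · refine ⟨5, ?_, fun i hi => ?_⟩
    · simp [hasMinWeight_hermDual_one_iff, hc, optimalMult]
    · by_contra h
      simp [hasMinWeight_hermDual_one_iff, hc, optimalMult, h] at hi
end
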